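/- Let F = ℂ(x) with derivation d/dx and let w be transcendental over F satisfying w' = x - w². Then there is no element α algebraic over ℂ(x), in a differential field extension of ℂ(x) with constants ℂ, satisfying α' = x - α². Consequently, the differential ring ℂ(x)[w] is differentially simple. -/

import Mathlib

section
open Polynomial

/-- auxiliary sequence -/
def rseq (n : ℕ) : ℕ → ℕ
  | 0 => 1
  | 1 => 0
  | (k+2) => (k+1) * (n-k) * rseq n k

lemma rseq_even (n i : ℕ) (hi : 2 * i ≤ n + 1) : 0 < rseq n (2*i) := by
  induction i with
  | zero => simp [rseq]
  | succ i ih =>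
    have : 2 * (i+1) = 2 * i + 2 := by ring
    rw [this, rseq]
    have := ih (by omega)
    have h2 : 0 < n - 2 * i := by omega
    positivity

lemma rseq_odd (n i : ℕ) : rseq n (2*i+1) = 0 := by
  induction i with
  | zero => simp [rseq]
  | succ i ih =>
    have : 2 * (i+1) + 1 = (2 * i + 1) + 2 := by ring
    rw [this, rseq, ih, mul_zero]

lemma scal (n : ℕ) (s : ℕ → ℂ) (h0 : s 1 = 0) (hn : s (n+1) = 0)
    (hrec : ∀ k, s (k+2) = - (((k+1) * (n-k) : ℕ) : ℂ) * s k) (k0 : ℕ) (hk0 : s k0 ≠ 0) :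
    ∑ k ∈ Finset.range (n+1), (-1:ℂ)^k * (s k * s (n-k)) ≠ 0 := by
  have hs : ∀ k, s k = Complex.I^k * (rseq n k : ℂ) * s 0 ∧
      s (k+1) = Complex.I^(k+1) * (rseq n (k+1) : ℂ) * s 0 := by
    intro k
    induction k with
    | zero => simp [rseq, h0]
    | succ k ih =>
      refine ⟨ih.2, ?_⟩
      rw [hrec k, ih.1, rseq]
      push_cast
      rw [pow_add _ k 2, Complex.I_sq]
      ring
  have hs0 : s 0 ≠ 0 := by
    intro h
    apply hk0
    rw [(hs k0).1, h, mul_zero]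
  obtain ⟨m, hm | hm⟩ := Nat.even_or_odd' n
  · have : ∑ k ∈ Finset.range (n+1), (-1:ℂ)^k * (s k * s (n-k)) =
      Complex.I^n * s 0 ^ 2 * ((∑ k ∈ Finset.range (n+1), rseq n k * rseq n (n-k) : ℕ) : ℂ) := by
      push_cast
      rw [Finset.mul_sum]
      apply Finset.sum_congr rfl
      intro k hk
      have hk' : k ≤ n := by simpa [Nat.lt_succ_iff] using hk
      rw [(hs k).1, (hs (n-k)).1]
      have e : Complex.I^n = Complex.I^k * Complex.I^(n-k) := by
        rw [← pow_add]; congr 1; omega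
      rw [e]
      obtain ⟨i, hi | hi⟩ := Nat.even_or_odd' k
      · have : (-1:ℂ)^k = 1 := by rw [hi, pow_mul]; simp
        rw [this]; ring
      · have : rseq n k = 0 := by rw [hi, rseq_odd]
        rw [this]; simp
    rw [this]
    have pos : 0 < ∑ k ∈ Finset.range (n+1), rseq n k * rseq n (n-k) := by
      apply Finset.sum_pos'
      · intros; positivity
      · refine ⟨0, by simp, ?_⟩
        have h1 := rseq_even n 0 (by omega)
        have h2 := rseq_even n m (by omega)
        rw [← hm] at h2
        simpa using Nat.mul_pos h1 h2
    refine mul_ne_zero (mul_ne_zero (pow_ne_zero _ Complex.I_ne_zero) (pow_ne_zero _ hs0)) ?_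
    exact_mod_cast pos.ne'
  · exfalso
    have h1 := rseq_even n (m+1) (by omega)
    have e : 2 * (m+1) = n + 1 := by omega
    rw [e] at h1
    rw [(hs (n+1)).1] at hn
    have h2 : (rseq n (n+1) : ℂ) ≠ 0 := by exact_mod_cast h1.ne'
    exact (mul_ne_zero (mul_ne_zero (pow_ne_zero _ Complex.I_ne_zero) h2) hs0) hn

lemma form_deriv (n : ℕ) (S : ℕ → ℂ[X]) (h : ℂ[X]) (hz : ∀ k, n < k → S k = 0)
    (hrec : ∀ i, derivative (S i) = h * S i - X * S (i+1)
      - ((i * (n+1-i) : ℕ) : ℂ[X]) * S (i-1)) :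
    derivative (∑ k ∈ Finset.range (n+1), (-1:ℂ[X])^k * (S k * S (n-k))) =
      2 * h * ∑ k ∈ Finset.range (n+1), (-1:ℂ[X])^k * (S k * S (n-k)) := by
  have t1 := Finset.sum_range_sub' (fun i => (-1:ℂ[X])^i * (S i * S (n+1-i))) (n+1)
  have t2 := Finset.sum_range_sub' (fun i => (-1:ℂ[X])^i * (((i * (n+1-i) : ℕ) : ℂ[X]) * S (i-1) * S (n-i))) (n+1)
  simp only [hz (n+1) (by omega), Nat.sub_self, Nat.sub_zero, mul_zero, zero_mul, sub_self,
    Nat.cast_zero] at t1 t2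
  have : derivative (∑ k ∈ Finset.range (n+1), (-1:ℂ[X])^k * (S k * S (n-k))) =
      2 * h * ∑ k ∈ Finset.range (n+1), (-1:ℂ[X])^k * (S k * S (n-k))
      - X * 0 - 0 := by
    nth_rewrite 1 [← t1]
    rw [← t2, derivative_sum, Finset.mul_sum, Finset.mul_sum, ← Finset.sum_sub_distrib,
      ← Finset.sum_sub_distrib]
    apply Finset.sum_congr rfl
    intro k hk
    have hk' : k ≤ n := by simpa [Nat.lt_succ_iff] using hk
    have e : derivative ((-1:ℂ[X])^k) = 0 := by
      rw [show (-1:ℂ[X])^k = C ((-1)^k) by simp]; exact derivative_C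
    rw [derivative_mul, e, derivative_mul, hrec k, hrec (n-k)]
    have e1 : n + 1 - (n - k) = k + 1 := by omega
    have e2 : n - k + 1 = n + 1 - k := by omega
    have e3 : n + 1 - (k + 1) = n - k := by omega
    have e4 : k + 1 - 1 = k := by omega
    have e5 : n - (k + 1) = n - k - 1 := by omega
    rw [e1, e2, e3, e4, e5, pow_succ]
    push_cast
    ring
  rw [this]; ring

lemma core (n : ℕ) (hn : 1 ≤ n) (S : ℕ → ℂ[X]) (h : ℂ[X]) (hz : ∀ k, n < k → S k = 0)
    (hSn : S n ≠ 0)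
    (hrec : ∀ i, derivative (S i) = h * S i - X * S (i+1)
      - ((i * (n+1-i) : ℕ) : ℂ[X]) * S (i-1)) : False := by
  set R : ℕ → ℂ[X] := fun k => X^k * expand ℂ 2 (S k) with hR
  set N := (Finset.range (n+1)).sup (fun k => (R k).natDegree) with hN
  have hRz : ∀ k, n < k → R k = 0 := by intro k hk; simp [hR, hz k hk]
  have hRN : ∀ k, (R k).natDegree ≤ N := by
    intro k
    by_cases hk : n < k
    · simp [hRz k hk]
    · exact Finset.le_sup (f := fun k => (R k).natDegree) (by simp; omega)
  have hdeg : ∀ k (p : ℂ[X]), p ≠ 0 → (X^k * expand ℂ 2 p).natDegree = k + p.natDegree * 2 := by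
    intro k p hp
    have : expand ℂ 2 p ≠ 0 := by rwa [Ne, expand_eq_zero (by norm_num)]
    rw [natDegree_mul (pow_ne_zero _ X_ne_zero) this, natDegree_expand, natDegree_X_pow]
  have hnN : n ≤ N := by
    have := hRN n
    rw [hR] at this
    simp only [hdeg n _ hSn] at this
    omega
  obtain ⟨k0, -, hk0⟩ := Finset.exists_mem_eq_sup (Finset.range (n+1)) ⟨0, by simp⟩
    (fun k => (R k).natDegree)
  rw [← hN] at hk0
  have hRk0 : R k0 ≠ 0 := by
    intro h0
    simp [h0] at hk0
    omega
  have hc0 : (R k0).coeff N ≠ 0 := by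
    rw [hk0]; simpa using hRk0
  have hE : ∀ k, (X^k * expand ℂ 2 (derivative (S k))).natDegree ≤ N := by
    intro k
    by_cases h0 : derivative (S k) = 0
    · simp [h0]
    · have h1 : S k ≠ 0 := by rintro h1; simp [h1] at h0
      have h2 := hRN k
      simp only [hR] at h2
      rw [hdeg k _ h1] at h2
      rw [hdeg k _ h0]
      have := natDegree_derivative_le (S k)
      omega
  have hRrec : ∀ i, expand ℂ 2 h * R i = X^i * expand ℂ 2 (derivative (S i)) +
      X * (R (i+1) + ((i * (n+1-i) : ℕ) : ℂ[X]) * R (i-1)) := by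
    intro i
    rw [hrec i]
    simp only [hR, map_sub, map_mul, expand_X, map_natCast]
    rcases i with _ | i
    · simp; ring
    · simp only [Nat.add_sub_cancel]; ring
  have hXN : ∀ i, (X * (R (i+1) + ((i * (n+1-i) : ℕ) : ℂ[X]) * R (i-1))).natDegree ≤ N + 1 := by
    intro i
    refine natDegree_mul_le.trans ?_
    rw [natDegree_X, add_comm]
    gcongr
    refine natDegree_add_le_of_degree_le (hRN _) ?_
    refine natDegree_mul_le.trans ?_
    rw [natDegree_natCast]
    simpa using hRN _
  have hh : h.natDegree = 0 := by
    by_contra hd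
    have hne : h ≠ 0 := by rintro rfl; simp at hd
    have h1 : expand ℂ 2 h ≠ 0 := by rwa [Ne, expand_eq_zero (by norm_num)]
    have h2 := natDegree_mul h1 hRk0
    rw [hRrec k0, natDegree_expand, ← hk0] at h2
    have h3 := natDegree_add_le_of_degree_le ((hE k0).trans (Nat.le_succ N)) (hXN k0)
    simp only [Nat.succ_eq_add_one] at h3
    omega
  obtain ⟨c, rfl⟩ : ∃ c, h = C c := ⟨_, eq_C_of_natDegree_eq_zero hh⟩
  have hlead : ∀ i, (R (i+1)).coeff N + ((i * (n+1-i) : ℕ) : ℂ) * (R (i-1)).coeff N = 0 := by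
    intro i
    have h1 := congrArg (fun p => p.coeff (N+1)) (hRrec i)
    simp only [expand_C, coeff_C_mul, coeff_add, coeff_X_mul] at h1
    rw [coeff_eq_zero_of_natDegree_lt (Nat.lt_succ_of_le (hRN i)),
      coeff_eq_zero_of_natDegree_lt (Nat.lt_succ_of_le (hE i)), ← C_eq_natCast, coeff_C_mul] at h1
    rw [← zero_add (_ + _), ← h1, mul_zero]
  have hscal := scal n (fun k => (R k).coeff N) (by simpa using hlead 0)
    (by simp [hRz (n+1) (by omega)]) (by
      intro k
      have := hlead (k+1)
      rw [show n + 1 - (k+1) = n - k by omega, show k + 1 - 1 = k by omega] at this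
      linear_combination this) k0 hc0
  have hf := form_deriv n S (C c) hz hrec
  set f := ∑ k ∈ Finset.range (n+1), (-1:ℂ[X])^k * (S k * S (n-k)) with hfdef
  have hf0 : f.natDegree = 0 := by
    by_cases hc : c = 0
    · apply derivative_eq_zero.mp
      rw [hf, hc]; simp
    · by_contra hd
      have := natDegree_derivative_lt hd
      rw [hf, show (2:ℂ[X]) * C c = C (2 * c) by rw [C_mul]; rfl, natDegree_C_mul (by simpa using hc)] at this
      omega
  obtain ⟨e, he⟩ : ∃ e, f = C e := ⟨_, eq_C_of_natDegree_eq_zero hf0⟩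
  apply hscal
  have h5 : X^n * expand ℂ 2 f = ∑ k ∈ Finset.range (n+1), C ((-1:ℂ)^k) * (R k * R (n-k)) := by
    rw [hfdef, map_sum, Finset.mul_sum]
    apply Finset.sum_congr rfl
    intro k hk
    have hk' : k ≤ n := by simpa [Nat.lt_succ_iff] using hk
    have e : (X:ℂ[X])^n = X^k * X^(n-k) := by
      rw [← pow_add]; congr 1; omega
    rw [e]
    simp only [hR, map_mul, map_pow, map_neg, map_one]
    ring
  have h6 := congrArg (fun p => p.coeff (N+N)) h5
  simp only [finsetSum_coeff, coeff_C_mul] at h6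
  rw [he, expand_C, mul_comm, coeff_C_mul, coeff_X_pow, if_neg (by omega), mul_zero] at h6
  rw [h6]
  apply Finset.sum_congr rfl
  intro k hk
  rw [coeff_mul_add_eq_of_natDegree_le (hRN _) (hRN _)]

lemma exD (A : Type*) [CommRing A] (d : A → A) (hadd : ∀ p q, d (p + q) = d p + d q)
    (hmul : ∀ p q, d (p * q) = d p * q + p * d q) (v : A[X]) :
    ∃ D : A[X] → A[X], (∀ p q, D (p + q) = D p + D q) ∧
      (∀ p q, D (p * q) = D p * q + p * D q) ∧ (∀ a, D (C a) = C (d a)) ∧ D X = v ∧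
      ∀ p k, (D p).coeff k = d (p.coeff k) + (v * derivative p).coeff k := by
  let d' : Derivation ℤ A A := Derivation.mk' (AddMonoidHom.mk' d hadd).toIntLinearMap (by
    intro a b
    simp only [AddMonoidHom.coe_toIntLinearMap, AddMonoidHom.mk'_apply, hmul, smul_eq_mul]
    ring)
  let _ : Differential A := ⟨d'⟩
  have hd : ∀ a : A, Differential.deriv a = d a := fun a => rfl
  refine ⟨Differential.implicitDeriv v, by simp, ?_, ?_, by simp, ?_⟩
  · intro p q
    rw [Derivation.leibniz]
    simp only [smul_eq_mul]
    ring
  · intro a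
    rw [Differential.implicitDeriv_C, hd]
  · intro p k
    simp [Differential.implicitDeriv, hd, Differential.coeff_mapCoeffs]

lemma polyD (dF : RatFunc ℂ → RatFunc ℂ)
    (hFadd : ∀ p q : RatFunc ℂ, dF (p + q) = dF p + dF q)
    (hFmul : ∀ p q : RatFunc ℂ, dF (p * q) = dF p * q + p * dF q)
    (hFX : dF RatFunc.X = 1)
    (hFC : ∀ c : ℂ, dF (RatFunc.C c) = 0) (p : ℂ[X]) :
    dF (algebraMap ℂ[X] (RatFunc ℂ) p) = algebraMap ℂ[X] (RatFunc ℂ) (derivative p) := by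
  induction p using Polynomial.induction_on with
  | C a => simp [hFC]
  | add p q hp hq => simp [hFadd, hp, hq]
  | monomial n a ih =>
    rw [pow_succ, ← mul_assoc, map_mul, hFmul, ih, derivative_mul, RatFunc.algebraMap_X, hFX]
    simp

lemma noDarboux0 (D0 : ℂ[X][X] → ℂ[X][X])
    (hD0 : ∀ p k, (D0 p).coeff k = derivative (p.coeff k) +
      (((C X - X ^ 2 : ℂ[X][X])) * derivative p).coeff k)
    (V : ℂ[X][X]) (hV : 1 ≤ V.natDegree) (hdvd : V ∣ D0 V) : False := by
  have hV0 : V ≠ 0 := by rintro rfl; simp at hV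
  obtain ⟨q, hq⟩ := hdvd
  set n := V.natDegree with hn
  have hc0 : (D0 V).coeff 0 = derivative (V.coeff 0) + X * V.coeff 1 := by
    rw [hD0, sub_mul]; simp [coeff_derivative, coeff_X_pow_mul']
  have hc1 : (D0 V).coeff 1 = derivative (V.coeff 1) + X * (2 * V.coeff 2) := by
    rw [hD0, sub_mul]; simp [coeff_derivative, coeff_X_pow_mul']; ring
  have hc2 : ∀ k, (D0 V).coeff (k+2) = derivative (V.coeff (k+2)) +
      X * (((k:ℂ[X])+3) * V.coeff (k+3)) - ((k:ℂ[X])+1) * V.coeff (k+1) := by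
    intro k
    rw [hD0, sub_mul]; simp [coeff_derivative, coeff_X_pow_mul']; ring
  have hbig : ∀ k, n < k → V.coeff k = 0 := fun k hk => coeff_eq_zero_of_natDegree_lt hk
  have hdeg : (D0 V).natDegree ≤ n + 1 := by
    rw [natDegree_le_iff_coeff_eq_zero]
    intro k hk
    obtain ⟨k, rfl⟩ : ∃ j, k = j + 2 := ⟨k - 2, by omega⟩
    rw [hc2, hbig _ (by omega), hbig _ (by omega), hbig _ (by omega)]
    simp
  have hq1 : q.natDegree ≤ 1 := by
    by_cases hq0 : q = 0
    · simp [hq0]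
    rw [hq, natDegree_mul hV0 hq0] at hdeg
    omega
  obtain ⟨l, h, rfl⟩ := exists_eq_X_add_C_of_natDegree_le_one hq1
  have hcoef0 : (D0 V).coeff 0 = h * V.coeff 0 := by
    rw [hq]; simp [mul_add, ← mul_assoc]; ring
  have hcoef : ∀ k, (D0 V).coeff (k+1) = h * V.coeff (k+1) + l * V.coeff k := by
    intro k
    rw [hq, mul_add, ← mul_assoc, coeff_add, coeff_mul_X, coeff_mul_C, coeff_mul_C]; ring
  have hl : l = - (n : ℂ[X]) := by
    have h1 := hcoef n
    obtain ⟨m, hm⟩ : ∃ m, n = m + 1 := ⟨n - 1, by omega⟩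
    have hlead : V.coeff n ≠ 0 := by simpa [hn] using hV0
    rw [show n + 1 = m + 2 by omega, hc2, hbig _ (by omega), hbig _ (by omega), ← hm] at h1
    apply mul_right_cancel₀ hlead
    rw [hm]; rw [hm] at h1
    push_cast
    simp only [derivative_zero, mul_zero, zero_add, zero_sub] at h1
    rw [← h1]; ring
  refine core n hV (fun k => (k.factorial : ℂ[X]) * V.coeff k) h ?_ ?_ ?_
  · intro k hk; simp [hbig k hk]
  · refine mul_ne_zero (by exact_mod_cast Nat.factorial_ne_zero n) (by simpa [hn] using hV0)
  · intro i
    have hdn : ∀ (m : ℕ) (p : ℂ[X]), derivative ((m : ℂ[X]) * p) = (m : ℂ[X]) * derivative p := by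
      intro m p; simp
    simp only [hdn]
    rcases i with _ | _ | i
    · rw [hcoef0] at hc0
      simp
      linear_combination -hc0
    · have := hcoef 0
      rw [zero_add, hc1, hl] at this
      simp [Nat.factorial]
      linear_combination this
    · have := hcoef (i+1)
      rw [show i + 1 + 1 = i + 2 by rfl, hc2, hl] at this
      simp only [show i + 1 + 1 = i + 2 by rfl, show i + 2 + 1 = i + 3 by rfl,
        show i + 2 - 1 = i + 1 by omega]
      by_cases hin : i + 2 ≤ n + 1
      · obtain ⟨j, hj⟩ : ∃ j, n = i + 1 + j := ⟨n - (i+1), by omega⟩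
        rw [show n + 1 - (i+2) = j by omega]
        rw [hj] at this
        simp only [Nat.factorial_succ]
        push_cast
        push_cast at this
        linear_combination ((i+2) * (i+1) * (i.factorial : ℂ[X])) * this
      · simp [hbig (i+2) (by omega), hbig (i+3) (by omega), hbig (i+1) (by omega)]

lemma noDarboux (dF : RatFunc ℂ → RatFunc ℂ)
    (hFadd : ∀ p q : RatFunc ℂ, dF (p + q) = dF p + dF q)
    (hFmul : ∀ p q : RatFunc ℂ, dF (p * q) = dF p * q + p * dF q)
    (hFX : dF RatFunc.X = 1)
    (hFC : ∀ c : ℂ, dF (RatFunc.C c) = 0)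
    (D : (RatFunc ℂ)[X] → (RatFunc ℂ)[X])
    (hadd : ∀ p q, D (p + q) = D p + D q)
    (hmul : ∀ p q, D (p * q) = D p * q + p * D q)
    (hC : ∀ a : RatFunc ℂ, D (C a) = C (dF a))
    (hX : D X = C RatFunc.X - X ^ 2)
    (v : (RatFunc ℂ)[X]) (hv : 1 ≤ v.natDegree) (hdvd : v ∣ D v) : False := by
  have hv0 : v ≠ 0 := by rintro rfl; simp at hv
  obtain ⟨D0, a0, m0, C0, X0, k0⟩ := exD ℂ[X] (fun p => derivative p) (by simp)
    (by intro p q; rw [derivative_mul]) (C X - X ^ 2 : ℂ[X][X])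
  have hmap : ∀ U : ℂ[X][X], D (U.map (algebraMap ℂ[X] (RatFunc ℂ))) =
      (D0 U).map (algebraMap ℂ[X] (RatFunc ℂ)) := by
    intro U
    induction U using Polynomial.induction_on with
    | C a => rw [map_C, hC, C0, map_C, polyD dF hFadd hFmul hFX hFC]
    | add p q hp hq => rw [Polynomial.map_add, hadd, hp, hq, a0, Polynomial.map_add]
    | monomial n a ih =>
      rw [pow_succ, ← mul_assoc, Polynomial.map_mul, hmul, ih, m0 (C a * X ^ n) X, map_X, hX, X0]
      simp
  obtain ⟨b, hb, hbv⟩ := IsLocalization.integerNormalization_spec (nonZeroDivisors ℂ[X]) v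
  set U := IsLocalization.integerNormalization (nonZeroDivisors ℂ[X]) v with hU
  have hb0 : algebraMap ℂ[X] (RatFunc ℂ) b ≠ 0 := by
    simpa using nonZeroDivisors.ne_zero hb
  have hbv' : U.map (algebraMap ℂ[X] (RatFunc ℂ)) = C (algebraMap ℂ[X] (RatFunc ℂ) b) * v := by
    rw [hbv]
    ext k
    simp [Algebra.smul_def]
  have hU0 : U ≠ 0 := by
    intro h
    rw [h, Polynomial.map_zero] at hbv'
    exact mul_ne_zero (C_ne_zero.mpr hb0) hv0 hbv'.symm
  let _ : NormalizedGCDMonoid ℂ[X] := Classical.choice inferInstance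
  have hg : algebraMap ℂ[X] (RatFunc ℂ) U.content ≠ 0 := by
    simpa [content_eq_zero_iff] using hU0
  set W := U.primPart with hW
  have hprim : W.IsPrimitive := U.isPrimitive_primPart
  have hUW : U = C U.content * W := U.eq_C_content_mul_primPart
  have hWv : ∃ c : RatFunc ℂ, c ≠ 0 ∧ W.map (algebraMap ℂ[X] (RatFunc ℂ)) = C c * v := by
    refine ⟨(algebraMap ℂ[X] (RatFunc ℂ) U.content)⁻¹ * algebraMap ℂ[X] (RatFunc ℂ) b,
      mul_ne_zero (inv_ne_zero hg) hb0, ?_⟩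
    apply mul_left_cancel₀ (C_ne_zero.mpr hg)
    have : C (algebraMap ℂ[X] (RatFunc ℂ) U.content) * W.map (algebraMap ℂ[X] (RatFunc ℂ)) =
        U.map (algebraMap ℂ[X] (RatFunc ℂ)) := by
      conv_rhs => rw [hUW]
      simp
    rw [this, hbv', ← mul_assoc, ← C_mul, mul_inv_cancel_left₀ hg]
  obtain ⟨c, hc, hWc⟩ := hWv
  apply noDarboux0 D0 k0 W
  · rw [← natDegree_map_eq_of_injective (RatFunc.algebraMap_injective ℂ) W, hWc,
      natDegree_C_mul hc]
    exact hv
  · apply hprim.dvd_of_fraction_map_dvd_fraction_map (K := RatFunc ℂ)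
    rw [← hmap, hWc, hmul]
    have : C c * v ∣ v := (IsUnit.mul_left_dvd (isUnit_C.mpr hc.isUnit)).mpr dvd_rfl
    exact this.trans (dvd_add (dvd_mul_left _ _) (hdvd.mul_left _))

end

/-- Let `F = ℂ(x)` with derivation `d/dx` (the unique derivation with
`x' = 1` killing constants).  Then the Riccati equation `α' = x - α²` has no solution
`α` algebraic over `ℂ(x)` in any differential field extension of `ℂ(x)` whose field of
constants is `ℂ`.  Consequently, the differential ring `ℂ(x)[w]`, where `w` is an
indeterminate with `w' = x - w²`, is differentially simple. -/
theorem stmt_8 (dF : RatFunc ℂ → RatFunc ℂ)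
    (hFadd : ∀ p q : RatFunc ℂ, dF (p + q) = dF p + dF q)
    (hFmul : ∀ p q : RatFunc ℂ, dF (p * q) = dF p * q + p * dF q)
    (hFX : dF RatFunc.X = 1)
    (hFC : ∀ c : ℂ, dF (RatFunc.C c) = 0) :
    -- no algebraic solution of the Riccati equation in any differential extension
    (∀ (K : Type) (_ : Field K) (_ : Algebra (RatFunc ℂ) K) (dK : K → K),
      (∀ x y : K, dK (x + y) = dK x + dK y) →
      (∀ x y : K, dK (x * y) = dK x * y + x * dK y) →
      (∀ p : RatFunc ℂ, dK (algebraMap (RatFunc ℂ) K p) = algebraMap (RatFunc ℂ) K (dF p)) →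
      (∀ z : K, dK z = 0 → ∃ c : ℂ, z = algebraMap (RatFunc ℂ) K (RatFunc.C c)) →
      ∀ α : K, IsAlgebraic (RatFunc ℂ) α →
        dK α ≠ algebraMap (RatFunc ℂ) K RatFunc.X - α ^ 2) ∧
    -- consequently ℂ(x)[w] with w' = x - w² is differentially simple
    (∀ D : Polynomial (RatFunc ℂ) → Polynomial (RatFunc ℂ),
      (∀ p q, D (p + q) = D p + D q) →
      (∀ p q, D (p * q) = D p * q + p * D q) →
      (∀ a : RatFunc ℂ, D (Polynomial.C a) = Polynomial.C (dF a)) →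
      (D Polynomial.X = Polynomial.C RatFunc.X - Polynomial.X ^ 2) →
      ∀ I : Ideal (Polynomial (RatFunc ℂ)), (∀ p ∈ I, D p ∈ I) → I = ⊥ ∨ I = ⊤) := by
  refine ⟨?_, ?_⟩
  · intro K _ _ dK hKadd hKmul hKF _ α hα heq
    obtain ⟨D, hadd, hmul, hC, hX, -⟩ := exD (RatFunc ℂ) dF hFadd hFmul
      (Polynomial.C RatFunc.X - Polynomial.X ^ 2)
    have hev : ∀ p : Polynomial (RatFunc ℂ),
        Polynomial.aeval α (D p) = dK (Polynomial.aeval α p) := by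
      intro p
      induction p using Polynomial.induction_on with
      | C a => rw [hC, Polynomial.aeval_C, Polynomial.aeval_C, hKF]
      | add p q hp hq => rw [hadd, map_add, map_add, hKadd, hp, hq]
      | monomial n a ih =>
        rw [pow_succ, ← mul_assoc, hmul, map_add, map_mul, ih, map_mul _ (Polynomial.C a * Polynomial.X ^ n) Polynomial.X,
          hKmul _ (Polynomial.aeval α Polynomial.X), hX, Polynomial.aeval_X, heq]
        simp
    have hK0 : dK 0 = 0 := by simpa using hKadd 0 0
    refine noDarboux dF hFadd hFmul hFX hFC D hadd hmul hC hX (minpoly (RatFunc ℂ) α)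
      (minpoly.natDegree_pos hα.isIntegral) ?_
    rw [minpoly.dvd_iff, hev, minpoly.aeval, hK0]
  · intro D hadd hmul hC hX I hI
    obtain ⟨v, rfl⟩ : ∃ v, I = Ideal.span {v} :=
      ⟨_, (Submodule.IsPrincipal.span_singleton_generator I).symm⟩
    by_cases hv : v = 0
    · left; simp [hv]
    right
    by_contra htop
    refine noDarboux dF hFadd hFmul hFX hFC D hadd hmul hC hX v ?_
      (Ideal.mem_span_singleton.mp (hI v (Ideal.mem_span_singleton_self v)))
    by_contra hd
    apply htop
    rw [Ideal.span_singleton_eq_top, Polynomial.isUnit_iff_degree_eq_zero,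
      Polynomial.degree_eq_natDegree hv]
    have : v.natDegree = 0 := by omega
    simp [this]
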